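/- Let X be a compact Hausdorff space that is the union of countably many dense countably tight subspaces, and assume the countable power X^ω is homogeneous. Then |X| ≤ 𝔠. -/

import Mathlib

open Set Cardinal

/-- A topological space `Z` is countably tight if whenever a point lies in the closure
of a set `A`, it lies in the closure of a countable subset of `A`. -/
def CountablyTight (Z : Type*) [TopologicalSpace Z] : Prop :=
  ∀ (A : Set Z) (z : Z), z ∈ closure A → ∃ B ⊆ A, B.Countable ∧ z ∈ closure B

section WellOrder

variable {Ω : Type*} [LinearOrder Ω]

theorem exists_mem_forall_lt_of_countable (hΩ : ∀ a : Ω, (Iic a).Countable) {U : Set Ω}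
    (hU : ¬ U.Countable) {S : Set Ω} (hS : S.Countable) : ∃ a ∈ U, ∀ b ∈ S, b < a := by
  by_contra! h
  refine hU ((hS.biUnion fun b _ => hΩ b).mono fun a ha => ?_)
  obtain ⟨b, hb, hab⟩ := h a ha
  exact mem_biUnion hb hab

theorem exists_forall_lt_of_countable [Uncountable Ω] (hΩ : ∀ a : Ω, (Iic a).Countable)
    {S : Set Ω} (hS : S.Countable) : ∃ a, ∀ b ∈ S, b < a := by
  obtain ⟨a, -, ha⟩ := exists_mem_forall_lt_of_countable hΩ not_countable_univ hS
  exact ⟨a, ha⟩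

/-- Dependent choice along a well-order, for a relation that only looks at earlier values. -/
theorem exists_forall_of_local [WellFoundedLT Ω] {T : Type*} [Nonempty T]
    (R : Ω → (Ω → T) → T → Prop) (hR : ∀ a f, ∃ t, R a f t)
    (hloc : ∀ a f g t, (∀ b < a, f b = g b) → R a f t → R a g t) :
    ∃ f : Ω → T, ∀ a, R a f (f a) := by
  classical
  choose g hg using hR
  let F : (a : Ω) → ((b : Ω) → b < a → T) → T := fun a ih =>
    g a fun b => if h : b < a then ih b h else Classical.arbitrary T
  let f : Ω → T := WellFoundedLT.fix F
  refine ⟨f, fun a => ?_⟩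
  have hf : f a = g a fun b => if b < a then f b else Classical.arbitrary T := by
    change WellFoundedLT.fix F a = _
    rw [WellFoundedLT.fix_eq]
    simp only [F, f, dite_eq_ite]
  rw [hf]
  exact hloc a _ _ _ (fun b hb => by simp [hb]) (hg a _)

/-- A pressing-down lemma for regressive functions with finite sets as values. -/
theorem exists_not_countable_fiber [WellFoundedLT Ω] [Uncountable Ω]
    (hΩ : ∀ a : Ω, (Iic a).Countable) {κ : Type*} [Countable κ] (ε : Ω → Finset (Ω × κ))
    (hε : ∀ a, ∀ i ∈ ε a, i.1 < a) : ∃ e, ¬ {a | ε a = e}.Countable := by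
  by_contra! h
  choose g hg using fun e => exists_forall_lt_of_countable hΩ (h e)
  have hnext : ∀ d : Ω, ∃ d', d < d' ∧ ∀ e : Finset (Ω × κ), (∀ i ∈ e, i.1 < d) → g e < d' := by
    intro d
    have hc : {e : Finset (Ω × κ) | ∀ i ∈ e, i.1 < d}.Countable := by
      have h1 : (Iio d ×ˢ (univ : Set κ)).Countable :=
        ((hΩ d).mono Iio_subset_Iic_self).prod countable_univ
      refine ((countable_ofPred_finite_subset h1).preimage Finset.coe_injective).mono ?_
      intro e he
      refine ⟨e.finite_toSet, fun i hi => ⟨he i hi, mem_univ _⟩⟩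
    obtain ⟨d', hd'⟩ := exists_forall_lt_of_countable hΩ ((hc.image g).insert d)
    exact ⟨d', hd' d (mem_insert _ _), fun e he => hd' _ (mem_insert_of_mem _ ⟨e, he, rfl⟩)⟩
  choose nx hnx hnx' using hnext
  obtain ⟨a₀⟩ : Nonempty Ω := inferInstance
  let d : ℕ → Ω := fun n => nx^[n] a₀
  have hd : ∀ n, d (n + 1) = nx (d n) := fun n => Function.iterate_succ_apply' nx n a₀
  have hmono : Monotone d := monotone_nat_of_le_succ fun n => by
    rw [hd]; exact (hnx _).le
  obtain ⟨u, hu⟩ := exists_forall_lt_of_countable hΩ (countable_range d)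
  have hne : (upperBounds (range d)).Nonempty := ⟨u, fun b hb => (hu b hb).le⟩
  let δ := wellFounded_lt.min (upperBounds (range d)) hne
  have hδ : δ ∈ upperBounds (range d) := wellFounded_lt.min_mem _ hne
  have hδmin : ∀ x < δ, ∃ n, x < d n := by
    intro x hx
    by_contra! hcon
    exact wellFounded_lt.not_lt_min (upperBounds (range d)) (x := x)
      (by rintro _ ⟨n, rfl⟩; exact hcon n) hx
  have hfin : ∃ N, ∀ i ∈ ε δ, i.1 < d N := by
    choose! n hn using fun i (hi : i ∈ ε δ) => hδmin i.1 (hε δ i hi)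
    refine ⟨(ε δ).sup n, fun i hi => (hn i hi).trans_le (hmono (Finset.le_sup hi))⟩
  obtain ⟨N, hN⟩ := hfin
  have h1 : g (ε δ) < d (N + 1) := by rw [hd]; exact hnx' _ _ hN
  have h2 : d (N + 1) ≤ δ := hδ ⟨_, rfl⟩
  exact absurd (hg (ε δ) δ rfl) (not_lt.2 (h1.le.trans h2))

end WellOrder

theorem exists_subset_not_countable_diff {α : Type*} {U : Set α} (hU : ¬ U.Countable) :
    ∃ V ⊆ U, ¬ V.Countable ∧ ¬ (U \ V).Countable := by
  have : Infinite U := by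
    rw [Set.infinite_coe_iff]; exact fun h => hU h.countable
  obtain ⟨e⟩ : Nonempty (U ⊕ U ≃ U) := by
    rw [← Cardinal.eq, ← Cardinal.add_def, Cardinal.add_mk_eq_self]
  have hl : Function.Injective fun u : U => (e (Sum.inl u) : α) := fun a b h => by
    simpa using e.injective (Subtype.ext h)
  have hr : Function.Injective fun u : U => (e (Sum.inr u) : α) := fun a b h => by
    simpa using e.injective (Subtype.ext h)
  have hunc : ∀ (f : U → α), Function.Injective f → ¬ (range f).Countable := fun f hf h => by
    have := (countable_coe_iff.2 h)
    exact hU (countable_coe_iff.1 (hf.codRestrict (fun u => mem_range_self u)).countable)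
  refine ⟨range fun u : U => (e (Sum.inl u) : α), ?_, hunc _ hl, fun h => hunc _ hr (h.mono ?_)⟩
  · rintro _ ⟨u, rfl⟩; exact Subtype.coe_prop _
  · rintro _ ⟨u, rfl⟩
    refine ⟨Subtype.coe_prop _, ?_⟩
    rintro ⟨v, hv⟩
    simpa using e.injective (Subtype.ext hv)

theorem CountablyTight.exists_countable_subset {X : Type*} [TopologicalSpace X] {A Y : Set X}
    (h : CountablyTight A) (hY : Y ⊆ A) {p : X} (hp : p ∈ A) (hpY : p ∈ closure Y) :
    ∃ C ⊆ Y, C.Countable ∧ p ∈ closure C := by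
  obtain ⟨B, hB, hBc, hpB⟩ := h (Subtype.val ⁻¹' Y) ⟨p, hp⟩ (by
    rw [closure_subtype, Subtype.image_preimage_coe, inter_eq_right.2 hY]
    exact hpY)
  exact ⟨Subtype.val '' B, image_subset_iff.2 hB, hBc.image _, closure_subtype.1 hpB⟩

/-- A compact space that contains closed sets forming an uncountable independent family of
disjoint pairs is not a countable union of countably tight subspaces. -/
theorem not_forall_nonempty_iInter_of_countablyTight {X : Type*} [TopologicalSpace X]
    [CompactSpace X] (A : ℕ → Set X) (hct : ∀ n, CountablyTight ↥(A n))
    (hcover : ⋃ n, A n = Set.univ) {I : Type*} [LinearOrder I] [Uncountable I]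
    (hI : ∀ a : I, (Iic a).Countable) (B : I → Bool → Set X) (hB : ∀ i b, IsClosed (B i b))
    (hdisj : ∀ i, Disjoint (B i true) (B i false)) :
    ¬ ∀ q : I → Bool, (⋂ i, B i (q i)).Nonempty := by
  classical
  intro hne
  let Large : Set X → Prop := fun F => IsClosed F ∧ ∃ (D : Set I) (σ : I → Bool),
    ¬ Dᶜ.Countable ∧ ∀ q : I → Bool, (∀ i ∈ D, q i = σ i) → (F ∩ ⋂ i, B i (q i)).Nonempty
  have hlarge : Large univ :=
    ⟨isClosed_univ, ∅, fun _ => true, by simpa using not_countable_univ,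
      fun q _ => by simpa using hne q⟩
  have hLne : ∀ F, Large F → F.Nonempty := fun F ⟨_, D, σ, _, h⟩ =>
    (h σ fun _ _ => rfl).mono inter_subset_left
  obtain ⟨n, F, hF, hAF⟩ : ∃ n F, Large F ∧ ∀ F' ⊆ F, Large F' → (F' ∩ A n).Nonempty := by
    by_contra! h
    choose! next hsub hL hdis using h
    let F : ℕ → Set X := fun n => Nat.rec univ (fun n F => next n F) n
    have hF : ∀ n, Large (F n) := fun n => by
      induction n with
      | zero => exact hlarge
      | succ n ih => exact hL n _ ih
    obtain ⟨x, hx⟩ := IsCompact.nonempty_iInter_of_sequence_nonempty_isCompact_isClosed F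
      (fun n => hsub n _ (hF n)) (fun n => hLne _ (hF n)) (hF 0).1.isCompact (fun n => (hF n).1)
    obtain ⟨n, hn⟩ := mem_iUnion.1 (hcover ▸ mem_univ x : x ∈ ⋃ n, A n)
    have : x ∈ F (n + 1) ∩ A n := ⟨mem_iInter.1 hx (n + 1), hn⟩
    exact (hdis n _ (hF n)).subset this
  obtain ⟨hFc, D, σ, hD, hFB⟩ := hF
  obtain ⟨I₀, hI₀, hI₀u, hI₁u⟩ := exists_subset_not_countable_diff hD
  let Y : Set X := {y | y ∈ A n ∧ y ∈ F ∧ ∃ β, ∀ i ∈ I₀, y ∈ B i (decide (β ≤ i))}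
  have hYF : closure Y ⊆ F := closure_minimal (fun y hy => hy.2.1) hFc
  let F' : Set X := closure Y ∩ ⋂ i ∈ I₀, B i false
  have hF' : Large F' := by
    refine ⟨isClosed_closure.inter (isClosed_biInter fun i _ => hB i _), D ∪ I₀,
      fun i => if i ∈ I₀ then false else σ i, ?_, ?_⟩
    · rwa [compl_union, ← sdiff_eq]
    intro q hq
    have hq₀ : ∀ i ∈ I₀, q i = false := fun i hi => by simpa [hi] using hq i (Or.inr hi)
    have hqD : ∀ i ∈ D, q i = σ i := fun i hi => by
      have : i ∉ I₀ := fun h => hI₀ h hi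
      simpa [this] using hq i (Or.inl hi)
    suffices (closure Y ∩ ⋂ i, B i (q i)).Nonempty by
      obtain ⟨y, hy, hyB⟩ := this
      refine ⟨y, ⟨hy, mem_iInter₂.2 fun i hi => ?_⟩, hyB⟩
      rw [← hq₀ i hi]
      exact mem_iInter.1 hyB i
    refine isClosed_closure.isCompact.inter_iInter_nonempty _ (fun i => hB i _) fun J => ?_
    obtain ⟨β, hβ⟩ := exists_forall_lt_of_countable hI J.countable_toSet
    let τ : I → Bool := fun i => if i ∈ I₀ then decide (β ≤ i) else q i
    have hτJ : ∀ i ∈ J, τ i = q i := fun i hi => by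
      by_cases h : i ∈ I₀
      · simp [τ, h, hq₀ i h, hβ i hi]
      · simp [τ, h]
    obtain ⟨y, ⟨hyF, hyB⟩, hyA⟩ := hAF (F ∩ ⋂ i ∈ D ∪ I₀ ∪ J, B i (τ i)) inter_subset_left <| by
      refine ⟨hFc.inter (isClosed_biInter fun i _ => hB i _), D ∪ I₀ ∪ J, τ, ?_, ?_⟩
      · intro h
        refine hI₁u ((h.union J.countable_toSet).mono fun i hi => ?_)
        by_cases hiJ : i ∈ J
        · exact Or.inr hiJ
        · left
          rintro ((h | h) | h)
          · exact hi.1 h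
          · exact hi.2 h
          · exact hiJ h
      · intro r hr
        obtain ⟨y, hyF, hyB⟩ := hFB r fun i hi => by
          have : i ∉ I₀ := fun h => hI₀ h hi
          rw [hr i (Or.inl (Or.inl hi)), ← hqD i hi]
          simp [τ, this]
        refine ⟨y, ⟨hyF, mem_iInter₂.2 fun i hi => ?_⟩, hyB⟩
        rw [← hr i hi]
        exact mem_iInter.1 hyB i
    rw [mem_iInter₂] at hyB
    refine ⟨y, subset_closure ⟨hyA, hyF, β, fun i hi => ?_⟩, mem_iInter₂.2 fun i hi => ?_⟩
    · simpa [τ, hi] using hyB i (Or.inl (Or.inr hi))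
    · rw [← hτJ i hi]
      exact hyB i (Or.inr hi)
  obtain ⟨p, ⟨hpY, hpB⟩, hpA⟩ := hAF F' (inter_subset_left.trans hYF) hF'
  obtain ⟨C, hCY, hC, hpC⟩ := (hct n).exists_countable_subset (fun y hy => hy.1) hpA hpY
  choose! β hβ using fun y (hy : y ∈ C) => (hCY hy).2.2
  obtain ⟨i, hi, hiβ⟩ := exists_mem_forall_lt_of_countable hI hI₀u (hC.image β)
  have hCi : closure C ⊆ B i true := closure_minimal (fun y hy => by
    simpa [(hiβ _ (mem_image_of_mem β hy)).le] using hβ y hy i hi) (hB i true)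
  exact disjoint_left.1 (hdisj i) (hCi hpC) (mem_iInter₂.1 hpB i hi)

/-- The point `x` has a countable local π-base. -/
def HasCountablePiBase {X : Type*} [TopologicalSpace X] (x : X) : Prop :=
  ∃ 𝒪 : Set (Set X), 𝒪.Countable ∧ (∀ O ∈ 𝒪, IsOpen O ∧ O.Nonempty) ∧
    ∀ U : Set X, IsOpen U → x ∈ U → ∃ O ∈ 𝒪, O ⊆ U

open TopologicalSpace in
/-- In a compact Hausdorff space without points of countable π-character, any countable family of
pairs of open sets can be extended by a pair that splits all the basic boxes below a given one. -/
theorem exists_split_of_not_hasCountablePiBase {X : Type*} [TopologicalSpace X] [CompactSpace X]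
    [T2Space X] [Nonempty X] (hX : ∀ x : X, ¬ HasCountablePiBase x) {J : Type*}
    (P : J → Bool → Opens X) {s : Set J} (hs : s.Countable) :
    ∃ (Q : Bool → Opens X) (ε : Finset (J × Bool)), (∀ i ∈ ε, i.1 ∈ s) ∧
      Disjoint (closure (Q true : Set X)) (closure (Q false : Set X)) ∧
      (⋂ i ∈ ε, (P i.1 i.2 : Set X)).Nonempty ∧
      ∀ ε' : Finset (J × Bool), ε ⊆ ε' → (∀ i ∈ ε', i.1 ∈ s) →
        (⋂ i ∈ ε', (P i.1 i.2 : Set X)).Nonempty →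
        ∀ b, ((⋂ i ∈ ε', (P i.1 i.2 : Set X)) ∩ Q b).Nonempty := by
  classical
  let box : Set (J × Bool) → Set X := fun e => ⋂ i ∈ e, (P i.1 i.2 : Set X)
  have hU : ∀ x : X, ∃ U : Set X, IsOpen U ∧ x ∈ U ∧ ∀ e : Finset (J × Bool),
      (∀ i ∈ e, i.1 ∈ s) → (box e).Nonempty → ¬ box e ⊆ U := by
    intro x
    by_contra! hcon
    refine hX x ⟨{O | O ∈ box '' {e | e.Finite ∧ e ⊆ s ×ˢ Set.univ} ∧ O.Nonempty}, ?_, ?_, ?_⟩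
    · exact ((countable_ofPred_finite_subset (hs.prod countable_univ)).image box).mono
        fun O hO => hO.1
    · rintro _ ⟨⟨e, ⟨he, -⟩, rfl⟩, hne⟩
      exact ⟨he.isOpen_biInter fun i _ => (P i.1 i.2).isOpen, hne⟩
    · intro U hU hxU
      obtain ⟨e, he, hne, hsub⟩ := hcon U hU hxU
      exact ⟨box e, ⟨⟨e, ⟨e.finite_toSet, fun i hi => ⟨he i hi, mem_univ _⟩⟩, rfl⟩, hne⟩, hsub⟩
  choose U hUo hxU hUbox using hU
  have hV : ∀ x : X, ∃ V V' : Set X, IsOpen V ∧ IsOpen V' ∧ x ∈ V ∧ closure V ⊆ V' ∧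
      closure V' ⊆ U x := by
    intro x
    obtain ⟨V', hV'o, hxV', hV'U⟩ := normal_exists_closure_subset (isClosed_singleton (x := x))
      (hUo x) (singleton_subset_iff.2 (hxU x))
    obtain ⟨V, hVo, hxV, hVV'⟩ := normal_exists_closure_subset (isClosed_singleton (x := x))
      hV'o hxV'
    exact ⟨V, V', hVo, hV'o, singleton_subset_iff.1 hxV, hVV', hV'U⟩
  choose V V' hVo hV'o hxV hVV' hV'U using hV
  by_contra! hcon
  have key : ∀ t : Finset X, ∃ ε : Finset (J × Bool), (∀ i ∈ ε, i.1 ∈ s) ∧ (box ε).Nonempty ∧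
      ∀ x ∈ t, Disjoint (box ε) (V x) := by
    intro t
    induction t using Finset.induction_on with
    | empty => exact ⟨∅, by simp, by simp [box], by simp⟩
    | insert x t _ ih =>
      obtain ⟨ε, hεs, hεne, hεt⟩ := ih
      let Q : Bool → Opens X := fun b =>
        if b then ⟨V x, hVo x⟩ else ⟨(closure (V' x))ᶜ, isClosed_closure.isOpen_compl⟩
      obtain ⟨ε', hεε', hε's, hε'ne, b, hb⟩ := hcon Q ε hεs (by
        refine disjoint_left.2 fun y hy hy' => ?_
        have h1 : closure ((closure (V' x))ᶜ) ⊆ (V' x)ᶜ :=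
          closure_minimal (compl_subset_compl.2 subset_closure) (hV'o x).isClosed_compl
        exact h1 hy' (hVV' x hy)) hεne
      have hsub : box ε' ⊆ box ε := biInter_subset_biInter_left (by exact_mod_cast hεε')
      cases b with
      | false =>
        exfalso
        refine hUbox x ε' hε's hε'ne fun y hy => ?_
        by_contra hyU
        have : y ∈ (⋂ i ∈ ε', (P i.1 i.2 : Set X)) ∩ Q false := ⟨hy, fun h => hyU (hV'U x h)⟩
        exact hb.subset this
      | true =>
        refine ⟨ε', hε's, hε'ne, fun y hy => ?_⟩
        rcases Finset.mem_insert.1 hy with rfl | hy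
        · exact disjoint_iff_inter_eq_empty.2 hb
        · exact (hεt y hy).mono_left hsub
  obtain ⟨t, ht⟩ := isCompact_univ.elim_finite_subcover V hVo
    fun x _ => mem_iUnion.2 ⟨x, hxV x⟩
  obtain ⟨ε, -, ⟨y, hy⟩, hεt⟩ := key t
  obtain ⟨x, hx, hyx⟩ := mem_iUnion₂.1 (ht (mem_univ y))
  exact disjoint_left.1 (hεt x hx) hy hyx

open TopologicalSpace in
/-- A compact Hausdorff space without points of countable π-character contains an uncountable
independent family of disjoint pairs of closed sets. -/
theorem exists_independent_of_not_hasCountablePiBase {X : Type*} [TopologicalSpace X]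
    [CompactSpace X] [T2Space X] [Nonempty X] (hX : ∀ x : X, ¬ HasCountablePiBase x)
    {Ω : Type*} [LinearOrder Ω] [WellFoundedLT Ω] [Uncountable Ω]
    (hΩ : ∀ a : Ω, (Iic a).Countable) :
    ∃ (S : Set Ω) (B : Ω → Bool → Set X), ¬ S.Countable ∧ (∀ i b, IsClosed (B i b)) ∧
      (∀ i, Disjoint (B i true) (B i false)) ∧
      ∀ q : Ω → Bool, (⋂ i : S, B i (q i)).Nonempty := by
  classical
  obtain ⟨f, hf⟩ := exists_forall_of_local (Ω := Ω) (T := (Bool → Opens X) × Finset (Ω × Bool))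
    (fun a f t => (∀ i ∈ t.2, i.1 ∈ Iio a) ∧
      Disjoint (closure (t.1 true : Set X)) (closure (t.1 false : Set X)) ∧
      (⋂ i ∈ t.2, ((f i.1).1 i.2 : Set X)).Nonempty ∧
      ∀ ε' : Finset (Ω × Bool), t.2 ⊆ ε' → (∀ i ∈ ε', i.1 ∈ Iio a) →
        (⋂ i ∈ ε', ((f i.1).1 i.2 : Set X)).Nonempty →
        ∀ b, ((⋂ i ∈ ε', ((f i.1).1 i.2 : Set X)) ∩ t.1 b).Nonempty)
    (fun a f => by
      obtain ⟨Q, ε, h⟩ := exists_split_of_not_hasCountablePiBase hX (fun i => (f i).1)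
        ((hΩ a).mono Iio_subset_Iic_self)
      exact ⟨(Q, ε), h⟩)
    (by
      rintro a f g t hfg ⟨h1, h2, h3, h4⟩
      have hbox : ∀ e : Finset (Ω × Bool), (∀ i ∈ e, i.1 ∈ Iio a) →
          ⋂ i ∈ e, ((f i.1).1 i.2 : Set X) = ⋂ i ∈ e, ((g i.1).1 i.2 : Set X) := fun e he =>
        iInter₂_congr fun i hi => by rw [hfg _ (he i hi)]
      refine ⟨h1, h2, hbox _ h1 ▸ h3, fun ε' hε hε' hne b => ?_⟩
      rw [← hbox _ hε'] at hne ⊢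
      exact h4 ε' hε hε' hne b)
  choose hreg hdisj hne hsplit using hf
  obtain ⟨e, he⟩ := exists_not_countable_fiber hΩ (fun a => (f a).2) hreg
  refine ⟨{a | (f a).2 = e}, fun i b => closure ((f i).1 b : Set X), he,
    fun _ _ => isClosed_closure, hdisj, fun q => ?_⟩
  refine CompactSpace.iInter_nonempty (fun _ => isClosed_closure) fun t => ?_
  have key : ∀ t : Finset Ω, (∀ a ∈ t, (f a).2 = e) →
      (⋂ i ∈ e ∪ t.image fun a => (a, q a), ((f i.1).1 i.2 : Set X)).Nonempty := by
    intro t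
    refine Finset.induction_on_max t ?_ fun a t ht ih => ?_
    · intro _
      obtain ⟨a, ha⟩ : {a | (f a).2 = e}.Nonempty := by
        by_contra h
        rw [not_nonempty_iff_eq_empty] at h
        exact he (h ▸ countable_empty)
      have := hne a
      rw [show (f a).2 = e from ha] at this
      simpa using this
    · intro hte
      have ha := hte a (Finset.mem_insert_self _ _)
      obtain ⟨y, hy, hya⟩ := hsplit a _ (ha ▸ Finset.subset_union_left)
        (fun i hi => by
          rcases Finset.mem_union.1 hi with hi | hi
          · exact hreg a i (ha ▸ hi)
          · obtain ⟨c, hc, rfl⟩ := Finset.mem_image.1 hi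
            exact ht c hc)
        (ih fun c hc => hte c (Finset.mem_insert_of_mem hc)) (q a)
      refine ⟨y, mem_iInter₂.2 fun i hi => ?_⟩
      rw [Finset.image_insert, Finset.union_insert, Finset.mem_insert] at hi
      rcases hi with rfl | hi
      · exact hya
      · exact mem_iInter₂.1 hy i hi
  obtain ⟨y, hy⟩ := key (t.image Subtype.val) fun a ha => by
    obtain ⟨c, -, rfl⟩ := Finset.mem_image.1 ha
    exact c.2
  refine ⟨y, mem_iInter₂.2 fun i hi => subset_closure ?_⟩
  exact mem_iInter₂.1 hy (i.1, q i.1) (Finset.mem_union_right _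
    (Finset.mem_image_of_mem _ (Finset.mem_image_of_mem _ hi)))

/-- A compact Hausdorff space that is a countable union of countably tight subspaces has a point
of countable π-character. -/
theorem exists_hasCountablePiBase {X : Type*} [TopologicalSpace X] [CompactSpace X] [T2Space X]
    [Nonempty X] (A : ℕ → Set X) (hct : ∀ n, CountablyTight ↥(A n))
    (hcover : ⋃ n, A n = Set.univ) {Ω : Type*} [LinearOrder Ω] [WellFoundedLT Ω] [Uncountable Ω]
    (hΩ : ∀ a : Ω, (Iic a).Countable) : ∃ x : X, HasCountablePiBase x := by
  by_contra! hX
  obtain ⟨S, B, hS, hBc, hBd, hB⟩ := exists_independent_of_not_hasCountablePiBase hX hΩ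
  have : Uncountable S := by
    rw [← not_countable_iff]
    exact fun h => hS (countable_coe_iff.1 h)
  refine not_forall_nonempty_iInter_of_countablyTight A hct hcover (I := S)
    (fun a => ((hΩ a).preimage Subtype.val_injective).mono fun b hb => hb)
    (fun i => B i) (fun i => hBc i) (fun i => hBd i) fun q => ?_
  classical
  obtain ⟨x, hx⟩ := hB fun i => if h : i ∈ S then q ⟨i, h⟩ else true
  exact ⟨x, by simpa using hx⟩

/-- If all points of a compact Hausdorff space have countable π-character and the space is the
union of countably many dense countably tight subspaces, then some nonempty `Gδ` set is
separable. -/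
theorem exists_isGδ_isSeparable {X : Type*} [TopologicalSpace X] [CompactSpace X] [T2Space X]
    [Nonempty X] (A : ℕ → Set X) (hct : ∀ n, CountablyTight ↥(A n))
    (hcover : ⋃ n, A n = Set.univ) (E : X → ℕ → ℕ → X) (hEA : ∀ x n k, E x n k ∈ A n)
    (hE : ∀ x n, x ∈ closure (range (E x n)))
    {Ω : Type*} [LinearOrder Ω] [WellFoundedLT Ω] [Uncountable Ω]
    (hΩ : ∀ a : Ω, (Iic a).Countable) :
    ∃ G : Set X, IsGδ G ∧ G.Nonempty ∧ TopologicalSpace.IsSeparable G := by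
  by_contra! hG
  have hex : ∀ (G C : Set X), IsGδ G → IsClosed G → G.Nonempty → C.Countable →
      ∃ H ⊆ G, IsGδ H ∧ IsClosed H ∧ H.Nonempty ∧ Disjoint H (closure C) := by
    intro G C hGδ hGc hGne hC
    obtain ⟨x, hxG, hxC⟩ : ∃ x ∈ G, x ∉ closure C := by
      by_contra! h
      exact hG G hGδ hGne ⟨C, hC, h⟩
    obtain ⟨f, hf0, hf1, -⟩ := exists_continuous_zero_one_of_isClosed
      (isClosed_singleton (x := x)) (isClosed_closure (s := C)) (by simpa using hxC)
    refine ⟨G ∩ f ⁻¹' {0}, inter_subset_left, hGδ.inter ?_,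
      hGc.inter (isClosed_singleton.preimage f.continuous), ⟨x, hxG, hf0 rfl⟩, ?_⟩
    · exact IsGδ.preimage f.continuous isClosed_singleton.isGδ
    · refine disjoint_left.2 fun y hy hyC => ?_
      have h0 : f y = 0 := hy.2
      have h1 : f y = 1 := hf1 hyC
      exact zero_ne_one (h0.symm.trans h1)
  classical
  let T : Type _ := {t : X × Set X // IsGδ t.2 ∧ IsClosed t.2 ∧ t.1 ∈ t.2}
  obtain ⟨x₀⟩ : Nonempty X := inferInstance
  have : Nonempty T := ⟨⟨(x₀, univ), IsGδ.univ, isClosed_univ, mem_univ _⟩⟩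
  let C : Ω → (Ω → T) → Set X := fun a f => ⋃ b ∈ Iio a, ⋃ n, range (E (f b).1.1 n)
  obtain ⟨f, hf⟩ := exists_forall_of_local (Ω := Ω) (T := T)
    (fun a f t => (∀ b < a, ∀ c < b, (f b).1.2 ⊆ (f c).1.2) →
      (∀ b < a, t.1.2 ⊆ (f b).1.2) ∧ Disjoint t.1.2 (closure (C a f)))
    (fun a f => by
      by_cases hmono : ∀ b < a, ∀ c < b, (f b).1.2 ⊆ (f c).1.2
      · have hc : Countable (Iio a) := ((hΩ a).mono Iio_subset_Iic_self).to_subtype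
        have hne : (⋂ b : Iio a, (f b).1.2).Nonempty := by
          rcases isEmpty_or_nonempty (Iio a) with h | h
          · rw [iInter_of_empty]
            exact univ_nonempty
          refine IsCompact.nonempty_iInter_of_directed_nonempty_isCompact_isClosed _ ?_
            (fun b => ⟨_, (f b).2.2.2⟩) (fun b => (f b).2.2.1.isCompact) fun b => (f b).2.2.1
          intro b c
          rcases lt_trichotomy b.1 c.1 with h | h | h
          · exact ⟨c, hmono c c.2 b h, subset_rfl⟩
          · exact ⟨c, by rw [Subtype.ext h], subset_rfl⟩
          · exact ⟨b, subset_rfl, hmono b b.2 c h⟩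
        obtain ⟨H, hHG, hHδ, hHc, ⟨x, hx⟩, hHC⟩ := hex _ (C a f)
          (IsGδ.iInter fun b : Iio a => (f b).2.1) (isClosed_iInter fun b : Iio a => (f b).2.2.1) hne
          (((hΩ a).mono Iio_subset_Iic_self).biUnion fun b _ =>
            countable_iUnion fun n => countable_range _)
        exact ⟨⟨(x, H), hHδ, hHc, hx⟩, fun _ => ⟨fun b hb => hHG.trans
          (iInter_subset (fun b : Iio a => (f b).1.2) ⟨b, hb⟩), hHC⟩⟩
      · exact ⟨Classical.arbitrary T, fun h => absurd h hmono⟩)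
    (by
      intro a f g t hfg h hg
      have hC : C a f = C a g := iUnion₂_congr fun b hb => by rw [hfg b hb]
      rw [← hC]
      obtain ⟨h1, h2⟩ := h fun b hb c hc => by
        rw [hfg b hb, hfg c (hc.trans hb)]
        exact hg b hb c hc
      exact ⟨fun b hb => hfg b hb ▸ h1 b hb, h2⟩)
  have hmono : ∀ a, ∀ b < a, (f a).1.2 ⊆ (f b).1.2 := by
    intro a
    induction a using WellFoundedLT.induction with
    | ind a ih => exact (hf a ih).1
  have hdisj : ∀ a, Disjoint (f a).1.2 (closure (C a f)) := fun a => (hf a fun b _ => hmono b).2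
  obtain ⟨p, hp⟩ : (⋂ a : Ω, closure ((fun b => (f b).1.1) '' Ici a)).Nonempty := by
    refine IsCompact.nonempty_iInter_of_directed_nonempty_isCompact_isClosed _ ?_
      (fun a => ⟨_, subset_closure (mem_image_of_mem _ (mem_Ici.2 le_rfl))⟩)
      (fun _ => isClosed_closure.isCompact) fun _ => isClosed_closure
    exact directed_of_isDirected_le fun a b hab =>
      closure_mono (image_mono (Ici_subset_Ici.2 hab))
  rw [mem_iInter] at hp
  have hpH : ∀ a, p ∈ (f a).1.2 := fun a => by
    refine closure_minimal ?_ (f a).2.2.1 (hp a)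
    rintro _ ⟨b, hb, rfl⟩
    rcases (mem_Ici.1 hb).eq_or_lt with rfl | hab
    · exact (f a).2.2.2
    · exact hmono b a hab (f b).2.2.2
  obtain ⟨n, hn⟩ := mem_iUnion.1 (hcover ▸ mem_univ p : p ∈ ⋃ n, A n)
  have hpY : p ∈ closure (⋃ b, range (E (f b).1.1 n)) := by
    obtain ⟨a⟩ : Nonempty Ω := inferInstance
    refine closure_minimal ?_ isClosed_closure (hp a)
    rintro _ ⟨b, -, rfl⟩
    exact closure_mono (subset_iUnion _ b) (hE _ n)
  obtain ⟨D, hDY, hD, hpD⟩ := (hct n).exists_countable_subset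
    (iUnion_subset fun b => range_subset_iff.2 fun k => hEA _ n k) hn hpY
  choose! β hβ using fun y (hy : y ∈ D) => mem_iUnion.1 (hDY hy)
  obtain ⟨a, ha⟩ := exists_forall_lt_of_countable hΩ (hD.image β)
  refine disjoint_left.1 (hdisj a) (hpH a) (closure_mono (fun y hy => ?_) hpD)
  exact mem_biUnion (ha _ (mem_image_of_mem β hy)) (mem_iUnion.2 ⟨n, hβ y hy⟩)

/-- A set of size at most `𝔠` closed under at most `𝔠` many operations of countable arity. -/
theorem exists_mk_le_continuum_closed {X : Type*} {ι : Type} (hι : #ι ≤ continuum) (x₀ : X)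
    (Φ : ι → (ℕ → X) → X) :
    ∃ D : Set X, x₀ ∈ D ∧ #D ≤ continuum ∧ ∀ i (s : ℕ → X), (∀ n, s n ∈ D) → Φ i s ∈ D := by
  let β : Option ι → Type := fun o => o.elim Empty fun _ => ℕ
  let step : (Σ o : Option ι, β o → X) → X := fun
    | ⟨none, _⟩ => x₀
    | ⟨some i, s⟩ => Φ i s
  have hβ : ∀ o, #(β o) ≤ ℵ₀ := by
    rintro (_ | i)
    · exact (mk_eq_zero Empty).trans_le bot_le
    · exact mk_nat.le
  have hW : #(WType β) ≤ continuum := by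
    refine WType.cardinalMk_le_of_le' ?_
    calc (Cardinal.sum fun o => continuum ^ lift (#(β o)))
        ≤ Cardinal.sum fun _ : Option ι => continuum := Cardinal.sum_le_sum _ _ fun o => by
          rw [lift_id]
          exact (power_le_power_left continuum_ne_zero (hβ o)).trans continuum_power_aleph0.le
      _ ≤ continuum := by
          rw [Cardinal.sum_const, lift_id, lift_id, mk_option]
          exact (mul_le_mul' (add_le_add hι one_le_aleph0) le_rfl).trans
            (by rw [continuum_add_aleph0, continuum_mul_self])
  refine ⟨range (WType.elim X step), ⟨⟨none, Empty.elim⟩, rfl⟩, ?_, fun i s hs => ?_⟩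
  · have := mk_range_le_lift (f := WType.elim X step)
    rw [← lift_le.{0}]
    refine (this.trans (lift_le.2 hW)).trans ?_
    simp
  · choose w hw using hs
    refine ⟨⟨some i, w⟩, ?_⟩
    change Φ i (fun n => WType.elim X step (w n)) = Φ i s
    simp only [hw]

/-- A compact Hausdorff space covered by countably many countably tight subspaces, each of which
has every point in the closure of one of its countable subsets, has density at most `𝔠` if every
point lies in a separable `Gδ` set. -/
theorem exists_dense_mk_le_continuum {X : Type*} [TopologicalSpace X] [CompactSpace X] [T2Space X]
    [Nonempty X] (A : ℕ → Set X) (hct : ∀ n, CountablyTight ↥(A n))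
    (hcover : ⋃ n, A n = Set.univ) (E : X → ℕ → ℕ → X) (hEA : ∀ x n k, E x n k ∈ A n)
    (hE : ∀ x n, x ∈ closure (range (E x n))) (U : X → ℕ → Set X)
    (hU : ∀ x k, IsOpen (U x k)) (hxU : ∀ x k, x ∈ U x k)
    (hUs : ∀ x, TopologicalSpace.IsSeparable (⋂ k, U x k)) :
    ∃ D : Set X, Dense D ∧ #D ≤ continuum := by
  classical
  obtain ⟨x₀⟩ : Nonempty X := inferInstance
  have hS : ∀ x, ∃ S : ℕ → X, ⋂ k, U x k ⊆ closure (range S) := fun x => by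
    obtain ⟨c, hc, hsub⟩ := hUs x
    have hne : c.Nonempty := closure_nonempty_iff.1 ⟨x, hsub (mem_iInter.2 (hxU x))⟩
    obtain ⟨S, rfl⟩ := hc.exists_eq_range hne
    exact ⟨S, hsub⟩
  choose S hS using hS
  have hcode : ∀ (N : ℕ → Set ℕ) (c : ℕ → X), ∃ t, (∃ t, ⋂ k, closure (c '' N k) ⊆ ⋂ k, U t k) →
      ⋂ k, closure (c '' N k) ⊆ ⋂ k, U t k := fun N c => by
    by_cases h : ∃ t, ⋂ k, closure (c '' N k) ⊆ ⋂ k, U t k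
    · exact ⟨h.choose, fun _ => h.choose_spec⟩
    · exact ⟨x₀, fun h' => absurd h' h⟩
  choose t ht using hcode
  have hout : ∀ (s : Finset (ℕ × ℕ)) (c : ℕ → X), ∃ z, (∃ z, ∀ p ∈ s, z ∉ U (c p.1) p.2) →
      ∀ p ∈ s, z ∉ U (c p.1) p.2 := fun s c => by
    by_cases h : ∃ z, ∀ p ∈ s, z ∉ U (c p.1) p.2
    · exact ⟨h.choose, fun _ => h.choose_spec⟩
    · exact ⟨x₀, fun h' => absurd h' h⟩
  choose out hout using hout
  obtain ⟨D, hx₀, hD, hclosed⟩ := exists_mk_le_continuum_closed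
    (ι := (ℕ → Set ℕ) ⊕ ((ℕ × ℕ) ⊕ (ℕ ⊕ Finset (ℕ × ℕ))))
    (by
      have h1 : #(ℕ → Set ℕ) ≤ continuum := by simp
      have h2 : #((ℕ × ℕ) ⊕ (ℕ ⊕ Finset (ℕ × ℕ))) ≤ continuum :=
        mk_le_aleph0.trans aleph0_le_continuum
      rw [← Cardinal.add_def]
      exact (add_le_add h1 h2).trans continuum_add_self.le) x₀
    (fun i c => match i with
      | Sum.inl N => t N c
      | Sum.inr (Sum.inl p) => E (c 0) p.1 p.2
      | Sum.inr (Sum.inr (Sum.inl k)) => S (c 0) k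
      | Sum.inr (Sum.inr (Sum.inr s)) => out s c)
  have htD : ∀ N c, (∀ n, c n ∈ D) → t N c ∈ D := fun N => hclosed (Sum.inl N)
  have hED : ∀ d ∈ D, ∀ n k, E d n k ∈ D := fun d hd n k =>
    hclosed (Sum.inr (Sum.inl (n, k))) (fun _ => d) fun _ => hd
  have hSD : ∀ d ∈ D, ∀ k, S d k ∈ D := fun d hd k =>
    hclosed (Sum.inr (Sum.inr (Sum.inl k))) (fun _ => d) fun _ => hd
  have houtD : ∀ s c, (∀ n, c n ∈ D) → out s c ∈ D := fun s =>
    hclosed (Sum.inr (Sum.inr (Sum.inr s)))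
  have hseq : ∀ x ∈ closure D, ∃ c : ℕ → X, (∀ n, c n ∈ D) ∧ x ∈ closure (range c) := by
    intro x hx
    obtain ⟨n, hn⟩ := mem_iUnion.1 (hcover ▸ mem_univ x : x ∈ ⋃ n, A n)
    have hxY : x ∈ closure (⋃ d ∈ D, range (E d n)) :=
      closure_minimal (fun d hd => closure_mono (subset_biUnion_of_mem hd) (hE d n))
        isClosed_closure hx
    obtain ⟨C, hCY, hC, hxC⟩ := (hct n).exists_countable_subset
      (iUnion₂_subset fun d _ => range_subset_iff.2 fun k => hEA d n k) hn hxY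
    obtain ⟨c, rfl⟩ := hC.exists_eq_range (closure_nonempty_iff.1 ⟨x, hxC⟩)
    refine ⟨c, fun m => ?_, hxC⟩
    obtain ⟨d, hd, k, hk⟩ := mem_iUnion₂.1 (hCY (mem_range_self m))
    rw [← hk]
    exact hED d hd n k
  have hmem : ∀ x ∈ closure D, ∃ d ∈ D, x ∈ ⋂ k, U d k := by
    intro x hx
    obtain ⟨c, hcD, hxc⟩ := hseq x hx
    have hV : ∀ k, ∃ V, IsOpen V ∧ x ∈ V ∧ closure V ⊆ U x k := fun k => by
      obtain ⟨V, hVo, hxV, hVU⟩ := normal_exists_closure_subset (isClosed_singleton (x := x))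
        (hU x k) (singleton_subset_iff.2 (hxU x k))
      exact ⟨V, hVo, singleton_subset_iff.1 hxV, hVU⟩
    choose V hVo hxV hVU using hV
    refine ⟨t (fun k => c ⁻¹' V k) c, htD _ c hcD, ht _ _ ⟨x, ?_⟩ ?_⟩
    · refine iInter_mono fun k => (closure_mono ?_).trans (hVU k)
      exact image_preimage_subset _ _
    · refine mem_iInter.2 fun k => ?_
      rw [image_preimage_eq_inter_range]
      exact (hVo k).inter_closure ⟨hxV k, hxc⟩
  refine ⟨D, fun z => ?_, hD⟩
  by_contra hz
  let P : Type _ := {p : X × ℕ // p.1 ∈ D ∧ z ∉ U p.1 p.2}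
  obtain ⟨u, hu⟩ := isClosed_closure.isCompact.elim_finite_subcover
    (fun p : P => U p.1.1 p.1.2) (fun p => hU _ _) (s := closure D) fun x hx => by
      obtain ⟨d, hd, hxd⟩ := hmem x hx
      have hzd : z ∉ ⋂ k, U d k := fun h => by
        refine hz (closure_mono ?_ (hS d h))
        exact range_subset_iff.2 (hSD d hd)
      obtain ⟨k, hk⟩ : ∃ k, z ∉ U d k := by simpa using hzd
      exact mem_iUnion.2 ⟨⟨(d, k), hd, hk⟩, mem_iInter.1 hxd k⟩
  obtain ⟨c, hc⟩ := ((u.image fun p : P => p.1.1).countable_toSet.insert x₀).exists_eq_range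
    (insert_nonempty _ _)
  have hcD : ∀ n, c n ∈ D := fun n => by
    have : c n ∈ insert x₀ (↑(u.image fun p : P => p.1.1) : Set X) := hc ▸ mem_range_self n
    rcases this with h | h
    · rw [h]; exact hx₀
    · obtain ⟨p, -, hp⟩ := Finset.mem_image.1 (Finset.mem_coe.1 h)
      rw [← hp]; exact p.2.1
  have hi : ∀ p ∈ u, ∃ i, c i = p.1.1 := fun p hp => by
    have : p.1.1 ∈ range c := by
      rw [← hc]
      exact mem_insert_of_mem _ (Finset.mem_coe.2 (Finset.mem_image_of_mem _ hp))
    exact this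
  choose! i hi using hi
  have hw := hout (u.image fun p => (i p, p.1.2)) c ⟨z, fun q hq => by
    obtain ⟨p, hp, rfl⟩ := Finset.mem_image.1 hq
    rw [hi p hp]
    exact p.2.2⟩
  obtain ⟨p, hp, hwp⟩ := mem_iUnion₂.1 (hu (subset_closure (houtD _ c hcD)))
  refine hw (i p, p.1.2) (Finset.mem_image_of_mem _ hp) ?_
  rw [hi p hp]
  exact hwp

theorem HasCountablePiBase.of_isOpenMap {X Y : Type*} [TopologicalSpace X] [TopologicalSpace Y]
    {f : X → Y} {x : X} (h : HasCountablePiBase x) (hf : Continuous f) (hfo : IsOpenMap f) :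
    HasCountablePiBase (f x) := by
  obtain ⟨𝒪, hc, ho, hbase⟩ := h
  refine ⟨image f '' 𝒪, hc.image _, ?_, fun U hU hx => ?_⟩
  · rintro _ ⟨O, hO, rfl⟩
    exact ⟨hfo _ (ho O hO).1, (ho O hO).2.image f⟩
  · obtain ⟨O, hO, hOU⟩ := hbase (f ⁻¹' U) (hU.preimage hf) hx
    exact ⟨f '' O, mem_image_of_mem _ hO, image_subset_iff.2 hOU⟩

theorem HasCountablePiBase.const {X : Type*} [TopologicalSpace X] {x : X}
    (h : HasCountablePiBase x) : HasCountablePiBase (fun _ : ℕ => x) := by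
  classical
  obtain ⟨𝒪, hc, ho, hbase⟩ := h
  have : Countable 𝒪 := hc.to_subtype
  let box : Finset (ℕ × 𝒪) → Set (ℕ → X) := fun s => ⋂ p ∈ s, (fun y => y p.1) ⁻¹' p.2.1
  refine ⟨{B | B ∈ range box ∧ B.Nonempty}, (countable_range box).mono fun B hB => hB.1, ?_, ?_⟩
  · rintro _ ⟨⟨s, rfl⟩, hne⟩
    exact ⟨isOpen_biInter_finset fun p _ => (ho _ p.2.2).1.preimage (continuous_apply _), hne⟩
  · intro U hU hx
    obtain ⟨F, V, hV, hVU⟩ := isOpen_pi_iff.1 hU _ hx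
    have hO : ∀ i ∈ F, ∃ O : 𝒪, (O : Set X) ⊆ V i := fun i hi => by
      obtain ⟨O, hO, hOV⟩ := hbase (V i) (hV i hi).1 (hV i hi).2
      exact ⟨⟨O, hO⟩, hOV⟩
    obtain ⟨O₀, hO₀, -⟩ := hbase univ isOpen_univ (mem_univ x)
    have : Nonempty 𝒪 := ⟨⟨O₀, hO₀⟩⟩
    choose! O hO using hO
    refine ⟨box (F.image fun i => (i, O i)), ⟨mem_range_self _, ?_⟩, fun y hy => hVU ?_⟩
    · choose y hy using fun i => (ho _ (O i).2).2
      refine ⟨y, mem_iInter₂.2 fun p hp => ?_⟩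
      obtain ⟨i, -, rfl⟩ := Finset.mem_image.1 hp
      exact hy i
    · intro i hi
      exact hO i hi (mem_iInter₂.1 hy (i, O i) (Finset.mem_image_of_mem _ hi))

/-- In a homogeneous Hausdorff space of countable π-character, the cardinality is bounded by
`𝔠` as soon as the density is. -/
theorem mk_le_continuum_of_hasCountablePiBase {Z : Type*} [TopologicalSpace Z] [T2Space Z] {p : Z}
    (hp : HasCountablePiBase p) (hhom : ∀ x : Z, ∃ h : Z ≃ₜ Z, h p = x) {D : Set Z}
    (hD : Dense D) (hDc : #D ≤ continuum) : #Z ≤ continuum := by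
  obtain ⟨𝒪, hc, ho, hbase⟩ := hp
  obtain ⟨O₀, hO₀, -⟩ := hbase univ isOpen_univ (mem_univ p)
  obtain ⟨O, rfl⟩ := hc.exists_eq_range ⟨O₀, hO₀⟩
  choose h hh using hhom
  have hne : ∀ x n, ∃ d : D, (d : Z) ∈ h x '' O n := fun x n => by
    obtain ⟨d, hd, hdD⟩ := hD.inter_open_nonempty _
      ((h x).isOpenMap _ (ho _ (mem_range_self n)).1) ((ho _ (mem_range_self n)).2.image _)
    exact ⟨⟨d, hdD⟩, hd⟩
  choose f hf using hne
  have hinj : Function.Injective f := by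
    intro x y hxy
    by_contra hne
    obtain ⟨V, W, hV, hW, hxV, hyW, hVW⟩ := t2_separation hne
    obtain ⟨_, ⟨n, rfl⟩, hn⟩ := hbase (h x ⁻¹' V ∩ h y ⁻¹' W)
      ((hV.preimage (h x).continuous).inter (hW.preimage (h y).continuous))
      ⟨by simpa [hh] using hxV, by simpa [hh] using hyW⟩
    have h1 : (f x n : Z) ∈ V := image_subset_iff.2 (fun z hz => (hn hz).1) (hf x n)
    have h2 : (f y n : Z) ∈ W := image_subset_iff.2 (fun z hz => (hn hz).2) (hf y n)
    rw [hxy] at h1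
    exact disjoint_left.1 hVW h1 h2
  refine (mk_le_of_injective hinj).trans ?_
  have h1 : #(ℕ → D) = #D ^ ℵ₀ := by simp
  rw [h1, ← continuum_power_aleph0]
  exact power_le_power_right hDc

theorem stmt_11 {X : Type u} [TopologicalSpace X] [CompactSpace X] [T2Space X]
    (A : ℕ → Set X) (hct : ∀ n, CountablyTight ↥(A n)) (hdense : ∀ n, Dense (A n))
    (hcover : ⋃ n, A n = Set.univ)
    (hhom : ∀ x y : ℕ → X, ∃ h : (ℕ → X) ≃ₜ (ℕ → X), h x = y) :
    #X ≤ continuum := by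
  classical
  rcases isEmpty_or_nonempty X with hX | hX
  · exact (mk_eq_zero X).trans_le bot_le
  let Ω : Type := (aleph 1).ord.ToType
  have hΩ : ∀ a : Ω, (Iic a).Countable := fun a => by
    have h : (Iio a).Countable := by
      rw [← le_aleph0_iff_set_countable, ← Order.lt_succ_iff, succ_aleph0]
      simpa [Ω] using mk_Iio_lt a (by simp [Ω])
    rw [← Iio_insert]
    exact h.insert a
  have : Uncountable Ω := by
    rw [← aleph0_lt_mk_iff, mk_ord_toType]
    exact aleph0_lt_aleph_one
  obtain ⟨x₁, hx₁⟩ := exists_hasCountablePiBase A hct hcover hΩ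
  have hpi : ∀ y : ℕ → X, HasCountablePiBase y := fun y => by
    obtain ⟨h, rfl⟩ := hhom (fun _ => x₁) y
    exact hx₁.const.of_isOpenMap h.continuous h.isOpenMap
  have hpiX : ∀ x : X, HasCountablePiBase x := fun x =>
    (hpi fun _ => x).of_isOpenMap (f := fun y => y 0) (continuous_apply 0) (isOpenMap_eval 0)
  have hE : ∀ (x : X) (n : ℕ), ∃ e : ℕ → X, (∀ k, e k ∈ A n) ∧ x ∈ closure (range e) := by
    intro x n
    obtain ⟨𝒪, hc, ho, hbase⟩ := hpiX x
    obtain ⟨O₀, hO₀, -⟩ := hbase univ isOpen_univ (mem_univ x)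
    obtain ⟨O, rfl⟩ := hc.exists_eq_range ⟨O₀, hO₀⟩
    choose e he using fun k => (hdense n).inter_open_nonempty (O k)
      (ho _ (mem_range_self k)).1 (ho _ (mem_range_self k)).2
    refine ⟨e, fun k => (he k).2, mem_closure_iff.2 fun V hV hxV => ?_⟩
    obtain ⟨_, ⟨k, rfl⟩, hk⟩ := hbase V hV hxV
    exact ⟨e k, hk (he k).1, mem_range_self k⟩
  choose E hEA hE using hE
  obtain ⟨G, hGδ, ⟨x₂, hx₂⟩, hGs⟩ := exists_isGδ_isSeparable A hct hcover E hEA hE hΩ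
  have hsep : ∀ x : X, ∃ U : ℕ → Set X, (∀ k, IsOpen (U k)) ∧ (∀ k, x ∈ U k) ∧
      TopologicalSpace.IsSeparable (⋂ k, U k) := by
    intro x
    obtain ⟨h, hh⟩ := hhom (fun _ => x) (fun _ => x₂)
    let g : X → ℕ → X := fun z => h (Function.update (fun _ => x) 0 z)
    have hg : Continuous g := h.continuous.comp (continuous_const.update 0 continuous_id)
    have hgx : g x = fun _ => x₂ := by
      change h (Function.update (fun _ => x) 0 x) = _
      rw [← hh, Function.update_eq_self]
    have hδ : IsGδ (g ⁻¹' univ.pi fun _ => G) := by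
      have : g ⁻¹' (univ.pi fun _ => G) = ⋂ i, (fun z => g z i) ⁻¹' G := by
        ext z; simp
      rw [this]
      exact IsGδ.iInter fun i => hGδ.preimage ((continuous_apply i).comp hg)
    have hs : TopologicalSpace.IsSeparable (g ⁻¹' univ.pi fun _ => G) := by
      have h1 : TopologicalSpace.IsSeparable (univ.pi fun _ : ℕ => G) := .univ_pi fun _ => hGs
      have h2 := h1.image ((continuous_apply (0 : ℕ)).comp h.symm.continuous)
      refine h2.mono fun z hz => ⟨g z, hz, ?_⟩
      simp [g]
    obtain ⟨U, hU, hUeq⟩ := isGδ_iff_eq_iInter_nat.1 hδ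
    have hxm : x ∈ ⋂ n, U n := by
      rw [← hUeq, mem_preimage, hgx]
      exact fun _ _ => hx₂
    exact ⟨U, hU, mem_iInter.1 hxm, hUeq ▸ hs⟩
  choose U hU hxU hUs using hsep
  obtain ⟨D, hD, hDc⟩ := exists_dense_mk_le_continuum A hct hcover E hEA hE U hU hxU hUs
  have hDω : DenseRange (Pi.map fun (_ : ℕ) => ((↑) : D → X)) :=
    DenseRange.piMap fun _ => hD.denseRange_val
  have hZ : #(ℕ → X) ≤ continuum := by
    refine mk_le_continuum_of_hasCountablePiBase (hpi fun _ => x₁) (hhom _) hDω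
      (mk_range_le.trans ?_)
    have h1 : #(ℕ → D) = #D ^ ℵ₀ := by simp
    rw [h1, ← continuum_power_aleph0]
    exact power_le_power_right hDc
  exact (mk_le_of_injective (f := fun (x : X) (_ : ℕ) => x) fun x y h => congrFun h 0).trans hZ
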